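/- If A, B, C, D : Fin 2 → Matrix (Fin 2) (Fin 2) ℂ satisfy trace(A i * B j * C k * D l) = δ_{i,k} · δ_{j,l} for all i, j, k, l ∈ Fin 2, then each of the eight matrices A 0, A 1, B 0, B 1, C 0, C 1, D 0, D 1 is invertible (has rank 2). -/

import Mathlib

open Matrix

theorem Matrix.exists_eq_vecMulVec_of_det_eq_zero {K : Type*} [Field K]
    {M : Matrix (Fin 2) (Fin 2) K} (hM : M.det = 0) :
    ∃ u v : Fin 2 → K, M = vecMulVec u v := by
  obtain ⟨w, hw, hMw⟩ := exists_mulVec_eq_zero_iff.mpr hM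
  have hrow (i : Fin 2) : M i 0 * w 0 + M i 1 * w 1 = 0 := by
    simpa [mulVec, dotProduct, Fin.sum_univ_two] using congrFun hMw i
  by_cases h0 : w 0 = 0
  · have h1 : w 1 ≠ 0 := fun h1 => hw (by ext i; fin_cases i <;> simp [h0, h1])
    refine ⟨fun i => M i 0, ![1, 0], ?_⟩
    ext i j
    have hi : M i 1 = 0 := by simpa [h0, h1] using hrow i
    fin_cases j <;> simp [vecMulVec_apply, hi]
  · refine ⟨fun i => M i 1, ![-w 1 / w 0, 1], ?_⟩
    ext i j
    fin_cases j
    · simp only [vecMulVec_apply, Fin.zero_eta, cons_val_zero]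
      field_simp
      linear_combination hrow i
    · simp [vecMulVec_apply]

theorem Matrix.trace_vecMulVec_mul_mul_mul {K n : Type*} [CommRing K] [Fintype n]
    (u v : n → K) (X Y Z : Matrix n n K) :
    (vecMulVec u v * X * Y * Z).trace = (v ᵥ* X ᵥ* Y) ⬝ᵥ (Z *ᵥ u) := by
  rw [vecMulVec_mul, vecMulVec_mul, vecMulVec_mul, trace_vecMulVec, dotProduct_comm,
    ← dotProduct_mulVec]

theorem isUnit_of_trace_mul_eq_delta {K : Type*} [Field K]
    {A B C D : Fin 2 → Matrix (Fin 2) (Fin 2) K}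
    (h : ∀ i j k l : Fin 2,
      (A i * B j * C k * D l).trace = (if i = k then 1 else 0) * (if j = l then 1 else 0))
    (i : Fin 2) : IsUnit (A i) := by
  rw [isUnit_iff_isUnit_det, isUnit_iff_ne_zero]
  intro hdet
  obtain ⟨u, v, huv⟩ := exists_eq_vecMulVec_of_det_eq_zero hdet
  let P : Matrix (Fin 2) (Fin 2) K := of fun j => v ᵥ* B j
  let Q : Matrix (Fin 2) (Fin 2) K := of fun a l => (D l *ᵥ u) a
  have hPQ (k : Fin 2) : P * C k * Q = if i = k then 1 else 0 := by
    ext j l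
    have hjl : (P * C k * Q) j l = (A i * B j * C k * D l).trace := by
      rw [huv, trace_vecMulVec_mul_mul_mul]
      rfl
    rw [hjl, h]
    by_cases hk : i = k <;> simp [hk, one_apply]
  obtain ⟨k, hk⟩ := exists_ne i
  have hone : P * C i * Q = 1 := by simpa using hPQ i
  have hP : IsUnit P := IsUnit.of_mul_eq_one (C i * Q) (by rw [← Matrix.mul_assoc, hone])
  have hQ : IsUnit Q := IsUnit.of_mul_eq_one_right (P * C i) hone
  have hzero : P * C k * Q = 0 := by simpa [hk.symm] using hPQ k
  have hC : C k = 0 := by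
    rwa [hQ.mul_left_eq_zero, hP.mul_right_eq_zero] at hzero
  simpa [hC] using h k 0 k 0

theorem trace_mul_eq_delta_rotate {K n : Type*} [CommRing K] [Fintype n]
    {A B C D : Fin 2 → Matrix n n K}
    (h : ∀ i j k l : Fin 2,
      (A i * B j * C k * D l).trace = (if i = k then 1 else 0) * (if j = l then 1 else 0))
    (i j k l : Fin 2) :
    (B i * C j * D k * A l).trace = (if i = k then 1 else 0) * (if j = l then 1 else 0) := by
  rw [trace_mul_comm, ← Matrix.mul_assoc, ← Matrix.mul_assoc, h, mul_comm]
  simp only [eq_comm]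

/-- In any square-network solution of dimension 2, all eight matrices are
invertible (i.e. of rank 2). -/
theorem square_network_solution_matrices_invertible
    (A B C D : Fin 2 → Matrix (Fin 2) (Fin 2) ℂ)
    (h : ∀ i j k l : Fin 2,
      (A i * B j * C k * D l).trace =
        (if i = k then 1 else 0) * (if j = l then 1 else 0)) :
    IsUnit (A 0) ∧ IsUnit (A 1) ∧ IsUnit (B 0) ∧ IsUnit (B 1) ∧
    IsUnit (C 0) ∧ IsUnit (C 1) ∧ IsUnit (D 0) ∧ IsUnit (D 1) := by
  have hB := trace_mul_eq_delta_rotate h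
  have hC := trace_mul_eq_delta_rotate hB
  have hD := trace_mul_eq_delta_rotate hC
  exact ⟨isUnit_of_trace_mul_eq_delta h 0, isUnit_of_trace_mul_eq_delta h 1,
    isUnit_of_trace_mul_eq_delta hB 0, isUnit_of_trace_mul_eq_delta hB 1,
    isUnit_of_trace_mul_eq_delta hC 0, isUnit_of_trace_mul_eq_delta hC 1,
    isUnit_of_trace_mul_eq_delta hD 0, isUnit_of_trace_mul_eq_delta hD 1⟩
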